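/- arXiv:1811.01270 — 3 statements merged into one kernel-verified Lean document; each statement's English description precedes it below -/
import Mathlib

section
/- For every congestion policy C, if A is a non-redundant sgreedy strategy, then A is a symmetric (1+C(k))-equilibrium; that is, for every strategy B, U_A(B) ≤ (1 + C(k))·U_A(A). -/
open Finset

/-- `A` is a doubly-substochastic `M × T` matrix: boxes `1..M`, rounds `1..T`,
nonnegative entries, every row and every column sums to at most 1. -/
def Substochastic (M T : ℕ) (A : ℕ → ℕ → ℝ) : Prop :=
  (∀ x t, 0 ≤ A x t) ∧
  (∀ x ∈ Icc 1 M, ∑ t ∈ Icc 1 T, A x t ≤ 1) ∧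
  (∀ t ∈ Icc 1 T, ∑ x ∈ Icc 1 M, A x t ≤ 1)

/-- `N̄_A(x,t)`: the probability that `A` does not visit box `x` by (and including) round `t`. -/
def Nbar (A : ℕ → ℕ → ℝ) (x t : ℕ) : ℝ := 1 - ∑ s ∈ Icc 1 t, A x s

/-- `f` is a positive, nonincreasing probability distribution on boxes `1..M`. -/
def BoxDist (M : ℕ) (f : ℕ → ℝ) : Prop :=
  (∀ x ∈ Icc 1 M, 0 < f x) ∧
  (∀ x, 1 ≤ x → x + 1 ≤ M → f (x + 1) ≤ f x) ∧
  (∑ x ∈ Icc 1 M, f x = 1)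

/-- `C` is a congestion policy for `k` players: nonnegative, nonincreasing on `1..k`,
`C 1 = 1`, and `C ℓ < 1` for some `ℓ ≤ k`. -/
def Policy (k : ℕ) (C : ℕ → ℝ) : Prop :=
  (∀ ℓ, 1 ≤ ℓ → ℓ ≤ k → 0 ≤ C ℓ) ∧ (C 1 = 1) ∧
  (∀ ℓ ℓ', 1 ≤ ℓ → ℓ ≤ ℓ' → ℓ' ≤ k → C ℓ' ≤ C ℓ) ∧
  (∃ ℓ, 1 ≤ ℓ ∧ ℓ ≤ k ∧ C ℓ < 1)

/-- The value of box `x` at round `t` against `k-1` copies of `A`. -/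
def val (k : ℕ) (C f : ℕ → ℝ) (A : ℕ → ℕ → ℝ) (x t : ℕ) : ℝ :=
  f x * ∑ ℓ ∈ range k,
    C (ℓ + 1) * ((k - 1).choose ℓ : ℝ) * A x t ^ ℓ * Nbar A x t ^ (k - 1 - ℓ)

/-- The utility of `B` against `k-1` copies of `A`. -/
def util (M T k : ℕ) (C f : ℕ → ℝ) (A B : ℕ → ℕ → ℝ) : ℝ :=
  ∑ t ∈ Icc 1 T, ∑ x ∈ Icc 1 M, B x t * val k C f A x t

/-- `A` is non-redundant: each column `t ≤ min T M` sums to exactly 1. -/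
def NonRedundant (M T : ℕ) (A : ℕ → ℕ → ℝ) : Prop :=
  ∀ t, 1 ≤ t → t ≤ min T M → ∑ x ∈ Icc 1 M, A x t = 1

/-- `A` is self-greedy: for each round `t ≤ T` it is greedy at round `t` with respect to
`k-1` copies of itself. -/
def SGreedy (M T k : ℕ) (C f : ℕ → ℝ) (A : ℕ → ℕ → ℝ) : Prop :=
  ∀ t, 1 ≤ t → t ≤ T → ∀ B, Substochastic M T B →
    (∀ x s, s < t → B x s = A x s) →
    ∑ x ∈ Icc 1 M, B x t * val k C f A x t ≤ ∑ x ∈ Icc 1 M, A x t * val k C f A x t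

theorem Nbar_succ (A : ℕ → ℕ → ℝ) (x t : ℕ) : Nbar A x (t + 1) = Nbar A x t - A x (t + 1) := by
  unfold Nbar
  rw [sum_Icc_succ_top (by omega)]
  ring

theorem Nbar_zero (A : ℕ → ℕ → ℝ) (x : ℕ) : Nbar A x 0 = 1 := by simp [Nbar]

theorem Nbar_antitone {A : ℕ → ℕ → ℝ} (hA : ∀ x t, 0 ≤ A x t) (x : ℕ) : Antitone (Nbar A x) :=
  antitone_nat_of_succ_le fun t => by rw [Nbar_succ]; linarith [hA x (t + 1)]

theorem Substochastic.Nbar_nonneg {M T : ℕ} {A : ℕ → ℕ → ℝ} (hA : Substochastic M T A) {x t : ℕ}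
    (hx : x ∈ Icc 1 M) (ht : t ≤ T) : 0 ≤ Nbar A x t := by
  have h := Nbar_antitone hA.1 x ht
  have := hA.2.1 x hx
  unfold Nbar at h ⊢
  linarith

/-- Once a box has been visited almost surely, it is never visited again. -/
theorem Substochastic.eq_zero_of_Nbar_eq_zero {M T : ℕ} {A : ℕ → ℕ → ℝ}
    (hA : Substochastic M T A) {x s t : ℕ} (hx : x ∈ Icc 1 M) (hst : s < t) (ht : t ≤ T)
    (hs : Nbar A x s = 0) : A x t = 0 ∧ Nbar A x t = 0 := by
  obtain ⟨u, rfl⟩ : ∃ u, t = u + 1 := ⟨t - 1, by omega⟩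
  have h1 := hA.Nbar_nonneg hx ht
  have h2 := Nbar_antitone hA.1 x (show s ≤ u by omega)
  have h3 := hA.1 x (u + 1)
  have h4 := Nbar_succ A x u
  constructor <;> linarith

theorem val_term_nonneg {M T k : ℕ} {C : ℕ → ℝ} {A : ℕ → ℕ → ℝ} (hC : Policy k C)
    (hA : Substochastic M T A) {x t : ℕ} (hx : x ∈ Icc 1 M) (ht : t ≤ T) :
    ∀ ℓ ∈ range k,
      0 ≤ C (ℓ + 1) * ((k - 1).choose ℓ : ℝ) * A x t ^ ℓ * Nbar A x t ^ (k - 1 - ℓ) := by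
  intro ℓ hℓ
  have h1 := hC.1 (ℓ + 1) (by omega) (by have := mem_range.1 hℓ; omega)
  have h2 := hA.1 x t
  have h3 := hA.Nbar_nonneg hx ht
  positivity

theorem val_nonneg {M T k : ℕ} {f C : ℕ → ℝ} {A : ℕ → ℕ → ℝ} (hf : BoxDist M f)
    (hC : Policy k C) (hA : Substochastic M T A) {x t : ℕ} (hx : x ∈ Icc 1 M) (ht : t ≤ T) :
    0 ≤ val k C f A x t :=
  mul_nonneg (hf.1 x hx).le (sum_nonneg (val_term_nonneg hC hA hx ht))

theorem le_val {M T k : ℕ} {f C : ℕ → ℝ} {A : ℕ → ℕ → ℝ} (hk : 2 ≤ k) (hf : BoxDist M f)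
    (hC : Policy k C) (hA : Substochastic M T A) {x t : ℕ} (hx : x ∈ Icc 1 M) (ht : t ≤ T) :
    f x * Nbar A x t ^ (k - 1) ≤ val k C f A x t := by
  refine mul_le_mul_of_nonneg_left ?_ (hf.1 x hx).le
  have h := single_le_sum (val_term_nonneg hC hA hx ht)
    (mem_range.2 (show 0 < k by omega))
  simpa [hC.2.1] using h

theorem val_of_Nbar_eq_zero {k : ℕ} (hk : 2 ≤ k) (C f : ℕ → ℝ) {A : ℕ → ℕ → ℝ} {x t : ℕ}
    (h : Nbar A x t = 0) : val k C f A x t = f x * (C k * A x t ^ (k - 1)) := by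
  unfold _root_.val
  rw [sum_eq_single (k - 1)]
  · rw [show k - 1 + 1 = k by omega]
    simp
  · intro ℓ hℓ hne
    have : k - 1 - ℓ ≠ 0 := by have := mem_range.1 hℓ; omega
    simp [h, this]
  · intro hk'
    exact absurd (mem_range.2 (by omega)) hk'

theorem val_of_Nbar_eq_zero_of_lt {M T k : ℕ} (hk : 2 ≤ k) (C f : ℕ → ℝ) {A : ℕ → ℕ → ℝ}
    (hA : Substochastic M T A) {x s t : ℕ} (hx : x ∈ Icc 1 M) (hst : s < t) (ht : t ≤ T)
    (hs : Nbar A x s = 0) : val k C f A x t = 0 := by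
  obtain ⟨h1, h2⟩ := hA.eq_zero_of_Nbar_eq_zero hx hst ht hs
  have : k - 1 ≠ 0 := by omega
  simp [val_of_Nbar_eq_zero hk C f h2, h1, this]

/-- Exchange property of sgreedy strategies: no mass can be moved to a more valuable box. -/
theorem SGreedy.val_le_val {M T k : ℕ} {f C : ℕ → ℝ} {A : ℕ → ℕ → ℝ}
    (hA : Substochastic M T A) (hSG : SGreedy M T k C f A) {x y t : ℕ} (hx : x ∈ Icc 1 M)
    (hy : y ∈ Icc 1 M) (ht : t + 1 ≤ T) (hxt : 0 < A x (t + 1))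
    (hyt : A y (t + 1) < Nbar A y t) :
    val k C f A y (t + 1) ≤ val k C f A x (t + 1) := by
  rcases eq_or_ne x y with rfl | hxy
  · exact le_rfl
  obtain ⟨ε, hε, hεx, hεy⟩ : ∃ ε : ℝ, 0 < ε ∧ ε ≤ A x (t + 1) ∧ ε ≤ Nbar A y t - A y (t + 1) :=
    ⟨min (A x (t + 1)) (Nbar A y t - A y (t + 1)), lt_min hxt (by linarith),
      min_le_left _ _, min_le_right _ _⟩
  set D : ℕ → ℝ := fun z => (if z = y then ε else 0) - (if z = x then ε else 0) with hD
  set B : ℕ → ℕ → ℝ := fun z s =>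
    if s < t + 1 then A z s else if s = t + 1 then A z (t + 1) + D z else 0 with hB
  have hBt : ∀ z, B z (t + 1) = A z (t + 1) + D z := fun z => by simp [hB]
  have hBlt : ∀ z s, s < t + 1 → B z s = A z s := fun z s hs => if_pos hs
  have hDsum : ∀ g : ℕ → ℝ, ∑ z ∈ Icc 1 M, D z * g z = ε * g y - ε * g x := fun g => by
    simp only [hD, sub_mul, ite_mul, zero_mul, sum_sub_distrib, sum_ite_eq', hx, hy, if_true]
  have hcol : ∀ z, 0 ≤ A z (t + 1) + D z := fun z => by
    have := hA.1 z (t + 1)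
    by_cases h1 : z = x
    · subst h1
      simp only [hD, hxy, if_true, if_false]
      linarith
    · simp only [hD, h1, if_false]
      split_ifs <;> linarith
  have hsub : Substochastic M T B := by
    refine ⟨fun z s => ?_, fun z hz => ?_, fun s hs => ?_⟩
    · simp only [hB]
      split_ifs
      exacts [hA.1 z s, hcol z, le_rfl]
    · have h1 : ∑ s ∈ Icc 1 T, B z s = ∑ s ∈ Icc 1 (t + 1), B z s := by
        refine (sum_subset (Icc_subset_Icc_right ht) fun s _ hs' => ?_).symm
        have : t + 1 < s := by
          by_contra! h
          simp_all
        simp only [hB]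
        rw [if_neg (by omega), if_neg (by omega)]
      have h2 : ∑ s ∈ Icc 1 t, B z s = ∑ s ∈ Icc 1 t, A z s :=
        sum_congr rfl fun s hs => hBlt z s (by have := mem_Icc.1 hs; omega)
      rw [h1, sum_Icc_succ_top (by omega), h2, hBt]
      have h3 := hA.Nbar_nonneg hz ht
      rw [Nbar_succ] at h3
      have h4 : Nbar A z t = 1 - ∑ s ∈ Icc 1 t, A z s := rfl
      by_cases h : z = y
      · subst h
        simp only [hD, hxy.symm, if_true, if_false]
        linarith
      · simp only [hD, h, if_false]
        split_ifs <;> linarith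
    · have h0 := hA.2.2 s hs
      rcases lt_trichotomy s (t + 1) with h | rfl | h
      · simpa only [hBlt _ s h] using h0
      · simp only [hBt, sum_add_distrib]
        have := hDsum fun _ => 1
        simp only [mul_one, sub_self] at this
        linarith
      · simp only [hB, if_neg h.not_gt, if_neg h.ne']
        simp
  have h := hSG (t + 1) (by omega) ht B hsub hBlt
  simp only [hBt, add_mul, sum_add_distrib, hDsum] at h
  nlinarith

/-- If the first `M` rounds are full, then every box has been visited after `M` rounds. -/
theorem NonRedundant.Nbar_eq_zero {M T : ℕ} {A : ℕ → ℕ → ℝ} (hA : Substochastic M T A)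
    (hNR : NonRedundant M T A) (hMT : M ≤ T) {x : ℕ} (hx : x ∈ Icc 1 M) : Nbar A x M = 0 := by
  have hsum : ∑ x ∈ Icc 1 M, Nbar A x M = 0 := by
    unfold Nbar
    rw [sum_sub_distrib, sum_comm, sum_congr rfl fun t ht => hNR t (mem_Icc.1 ht).1
      (le_min ((mem_Icc.1 ht).2.trans hMT) (mem_Icc.1 ht).2)]
    simp
  exact (sum_eq_zero_iff_of_nonneg fun z hz => hA.Nbar_nonneg hz hMT).1 hsum x hx

/-- In every round, a non-redundant sgreedy strategy exhausts the boxes whose value exceeds a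
certain threshold, and avoids those whose value is below it. -/
theorem SGreedy.exists_threshold {M T k : ℕ} (hk : 2 ≤ k) {f C : ℕ → ℝ} (hf : BoxDist M f)
    (hC : Policy k C) {A : ℕ → ℕ → ℝ} (hA : Substochastic M T A) (hNR : NonRedundant M T A)
    (hSG : SGreedy M T k C f A) {t : ℕ} (ht : t ∈ Icc 1 T) :
    ∃ c : ℝ, 0 ≤ c ∧ c * ∑ x ∈ Icc 1 M, A x t = c ∧
      (∀ x ∈ Icc 1 M, val k C f A x t < c → A x t = 0) ∧
      (∀ x ∈ Icc 1 M, c < val k C f A x t → Nbar A x t = 0) := by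
  obtain ⟨ht1, htT⟩ := mem_Icc.1 ht
  rcases le_or_gt t M with htM | htM
  · have hsum := hNR t ht1 (le_min htT htM)
    have hne : ((Icc 1 M).filter fun x => 0 < A x t).Nonempty := by
      obtain ⟨x, hx, hpos⟩ := exists_lt_of_sum_lt (s := Icc 1 M) (f := fun _ => (0 : ℝ))
        (g := fun x => A x t) (by rw [hsum]; simp)
      exact ⟨x, mem_filter.2 ⟨hx, hpos⟩⟩
    obtain ⟨x, hx, hmin⟩ := exists_min_image _ (fun x => val k C f A x t) hne
    obtain ⟨hxM, hxpos⟩ := mem_filter.1 hx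
    refine ⟨val k C f A x t, val_nonneg hf hC hA hxM htT, by rw [hsum, mul_one],
      fun y hy hlt => ?_, fun y hy hlt => ?_⟩
    · by_contra h
      exact hlt.not_ge (hmin y (mem_filter.2 ⟨hy, (hA.1 y t).lt_of_ne' h⟩))
    · obtain ⟨u, rfl⟩ : ∃ u, t = u + 1 := ⟨t - 1, by omega⟩
      by_contra h
      have h1 := (hA.Nbar_nonneg hy htT).lt_of_ne' h
      rw [Nbar_succ] at h1
      exact hlt.not_ge (hSG.val_le_val hA hxM hy htT hxpos (by linarith))
  · have hv : ∀ x ∈ Icc 1 M, val k C f A x t = 0 := fun x hx =>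
      val_of_Nbar_eq_zero_of_lt hk C f hA hx htM htT (hNR.Nbar_eq_zero hA (by omega) hx)
    refine ⟨0, le_rfl, zero_mul _, fun x hx h => ?_, fun x hx h => ?_⟩ <;>
    · rw [hv x hx] at h
      exact absurd h (lt_irrefl 0)

/-- For one box, the gain of any strategy over the round thresholds exceeds the gain of `A` by at
most `C k` times the utility `A` collects from that box. -/
theorem sum_excess_le {M T k : ℕ} (hk : 2 ≤ k) {f C : ℕ → ℝ} (hf : BoxDist M f)
    (hC : Policy k C) {A B : ℕ → ℕ → ℝ} (hA : Substochastic M T A) (hB : Substochastic M T B)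
    {c : ℕ → ℝ} (hc : ∀ t ∈ Icc 1 T, 0 ≤ c t) {x : ℕ} (hx : x ∈ Icc 1 M)
    (hfull : ∀ t ∈ Icc 1 T, c t < val k C f A x t → Nbar A x t = 0) :
    ∑ t ∈ Icc 1 T, B x t * max (val k C f A x t - c t) 0 ≤
      ∑ t ∈ Icc 1 T, A x t * max (val k C f A x t - c t) 0 +
        C k * ∑ t ∈ Icc 1 T, A x t * val k C f A x t := by
  have hCk : 0 ≤ C k := hC.1 k (by omega) le_rfl
  have hAe : ∀ t ∈ Icc 1 T, 0 ≤ A x t * max (val k C f A x t - c t) 0 := fun t _ =>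
    mul_nonneg (hA.1 x t) (le_max_right _ _)
  have hAv : ∀ t ∈ Icc 1 T, 0 ≤ A x t * val k C f A x t := fun t ht =>
    mul_nonneg (hA.1 x t) (val_nonneg hf hC hA hx (mem_Icc.1 ht).2)
  by_cases h : ∃ t ∈ Icc 1 T, c t < val k C f A x t
  swap
  · push Not at h
    rw [sum_eq_zero fun t ht => by rw [max_eq_right (by linarith [h t ht]), mul_zero]]
    exact add_nonneg (sum_nonneg hAe) (mul_nonneg hCk (sum_nonneg hAv))
  obtain ⟨t, ht, hlt⟩ := h
  obtain ⟨u, rfl⟩ : ∃ u, t = u + 1 := ⟨t - 1, by have := mem_Icc.1 ht; omega⟩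
  have htT := (mem_Icc.1 ht).2
  have hN := hfull _ ht hlt
  have hAN : A x (u + 1) = Nbar A x u := by linarith [Nbar_succ A x u]
  have hval := val_of_Nbar_eq_zero hk C f hN
  have hother : ∀ s ∈ Icc 1 T, s ≠ u + 1 → val k C f A x s ≤ c s := by
    intro s hs hne
    by_contra! hlt'
    rcases hne.lt_or_gt with hsu | hsu
    · rw [val_of_Nbar_eq_zero_of_lt hk C f hA hx hsu htT (hfull s hs hlt')] at hlt
      linarith [hc _ ht]
    · rw [val_of_Nbar_eq_zero_of_lt hk C f hA hx hsu (mem_Icc.1 hs).2 hN] at hlt'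
      linarith [hc s hs]
  have hBsum : ∑ s ∈ Icc 1 T, B x s * max (val k C f A x s - c s) 0 =
      B x (u + 1) * (val k C f A x (u + 1) - c (u + 1)) := by
    rw [sum_eq_single_of_mem _ ht fun s hs hne => by
      rw [max_eq_right (by linarith [hother s hs hne]), mul_zero], max_eq_left (by linarith)]
  have hAsum := single_le_sum hAe ht
  rw [max_eq_left (by linarith)] at hAsum
  have hB1 : B x (u + 1) ≤ 1 :=
    (single_le_sum (fun s _ => hB.1 x s) ht).trans (hB.2.1 x hx)
  have hNu := hA.Nbar_nonneg hx (show u ≤ T by omega)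
  have hprefix : (1 - Nbar A x u) * (f x * Nbar A x u ^ (k - 1)) ≤
      ∑ s ∈ Icc 1 T, A x s * val k C f A x s := by
    calc (1 - Nbar A x u) * (f x * Nbar A x u ^ (k - 1))
        = ∑ s ∈ Icc 1 u, A x s * (f x * Nbar A x u ^ (k - 1)) := by
          rw [← sum_mul]
          simp [Nbar]
      _ ≤ ∑ s ∈ Icc 1 u, A x s * val k C f A x s := by
          refine sum_le_sum fun s hs => mul_le_mul_of_nonneg_left ?_ (hA.1 x s)
          have hsu := (mem_Icc.1 hs).2
          refine le_trans ?_ (le_val hk hf hC hA hx (show s ≤ T by omega))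
          have := (hf.1 x hx).le
          have := Nbar_antitone hA.1 x hsu
          gcongr
      _ ≤ _ := sum_le_sum_of_subset_of_nonneg (Icc_subset_Icc_right (by omega))
          fun s hs _ => hAv s hs
  have hN1 : Nbar A x u ≤ 1 := Nbar_zero A x ▸ Nbar_antitone hA.1 x (Nat.zero_le u)
  rw [hAN] at hAsum hval
  rw [hBsum]
  have h1 : B x (u + 1) * (val k C f A x (u + 1) - c (u + 1)) ≤
      val k C f A x (u + 1) - c (u + 1) := mul_le_of_le_one_left (by linarith) hB1
  have h2 : (1 - Nbar A x u) * (val k C f A x (u + 1) - c (u + 1)) ≤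
      (1 - Nbar A x u) * val k C f A x (u + 1) :=
    mul_le_mul_of_nonneg_left (by linarith [hc _ ht]) (by linarith)
  have h3 : (1 - Nbar A x u) * val k C f A x (u + 1) ≤
      C k * ∑ s ∈ Icc 1 T, A x s * val k C f A x s :=
    le_of_eq_of_le (by rw [hval]; ring) (mul_le_mul_of_nonneg_left hprefix hCk)
  linarith

/-- a non-redundant sgreedy strategy is a symmetric `(1 + C k)`-equilibrium. -/
theorem sgreedy_is_approx_equilibrium
    (M T k : ℕ) (hM : 1 ≤ M) (hT : 1 ≤ T) (hk : 2 ≤ k)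
    (f C : ℕ → ℝ) (hf : BoxDist M f) (hC : Policy k C)
    (A : ℕ → ℕ → ℝ) (hA : Substochastic M T A)
    (hNR : NonRedundant M T A) (hSG : SGreedy M T k C f A) :
    ∀ B, Substochastic M T B →
      util M T k C f A B ≤ (1 + C k) * util M T k C f A A := by
  intro B hB
  choose! c hc0 hcsum hlow hfull using
    fun t (ht : t ∈ Icc 1 T) => hSG.exists_threshold hk hf hC hA hNR ht
  have hUA : util M T k C f A A = ∑ t ∈ Icc 1 T, c t +
      ∑ x ∈ Icc 1 M, ∑ t ∈ Icc 1 T, A x t * max (val k C f A x t - c t) 0 := by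
    rw [sum_comm (s := Icc 1 M), ← sum_add_distrib]
    refine sum_congr rfl fun t ht => ?_
    refine Eq.trans ?_ (congrArg (· + _) (hcsum t ht))
    simp only [mul_sum]
    rw [← sum_add_distrib]
    refine sum_congr rfl fun x hx => ?_
    rcases lt_or_ge (val k C f A x t) (c t) with h | h
    · simp [hlow t ht x hx h]
    · rw [max_eq_left (by linarith)]
      ring
  have hUB : util M T k C f A B ≤ ∑ t ∈ Icc 1 T, c t +
      ∑ x ∈ Icc 1 M, ∑ t ∈ Icc 1 T, B x t * max (val k C f A x t - c t) 0 := by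
    rw [sum_comm (s := Icc 1 M), ← sum_add_distrib]
    refine sum_le_sum fun t ht => ?_
    have h1 : c t * ∑ x ∈ Icc 1 M, B x t ≤ c t := mul_le_of_le_one_right (hc0 t ht) (hB.2.2 t ht)
    refine le_trans ?_ (add_le_add_left h1 _)
    rw [mul_sum, ← sum_add_distrib]
    refine sum_le_sum fun x _ => ?_
    have := mul_le_mul_of_nonneg_left (le_max_left (val k C f A x t - c t) 0) (hB.1 x t)
    linarith
  have hexcess := sum_le_sum fun x (hx : x ∈ Icc 1 M) =>
    sum_excess_le hk hf hC hA hB hc0 hx fun t ht => hfull t ht x hx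
  have hcomm : ∑ x ∈ Icc 1 M, ∑ t ∈ Icc 1 T, A x t * val k C f A x t = util M T k C f A A :=
    sum_comm
  rw [sum_add_distrib, ← mul_sum, hcomm] at hexcess
  linarith
end

section
/- The bound (1 − (1 − 1/k)^k)^{−1} on the price of anarchy of the exclusive policy is tight: let M = kT and let f be uniform, f(x) = 1/M for all x. Then under the exclusive policy the strategy A_unif whose matrix has A_unif(x,t) = 1/M for every x ≤ M and t ≤ T is a symmetric equilibrium for k players; its symmetric profile has success probability exactly 1 − (1 − 1/k)^k, while there exists a profile of k strategies (e.g., player i deterministically visits box i + (t−1)k at round t) whose success probability equals 1. -/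
open Finset

/-- The value of box `x` at round `t` against `k-1` copies of `A` under the exclusive policy. -/
def exVal (k : ℕ) (f : ℕ → ℝ) (A : ℕ → ℕ → ℝ) (x t : ℕ) : ℝ :=
  f x * Nbar A x t ^ (k - 1)

/-- The utility of `B` against `k-1` copies of `A` under the exclusive policy. -/
def exUtil (M T k : ℕ) (f : ℕ → ℝ) (A B : ℕ → ℕ → ℝ) : ℝ :=
  ∑ t ∈ Icc 1 T, ∑ x ∈ Icc 1 M, B x t * exVal k f A x t

/-- The success probability of the profile `P`. -/
def success (M T : ℕ) (f : ℕ → ℝ) (P : Multiset (ℕ → ℕ → ℝ)) : ℝ :=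
  ∑ x ∈ Icc 1 M, f x * (1 - (P.map fun A => Nbar A x T).prod)

/-- The strategy of player `i` in the profile that sweeps the boxes in blocks of `k`: box `x`
is visited by player `(x - 1) % k` at round `(x - 1) / k + 1`. -/
def sweep (k i x t : ℕ) : ℝ :=
  if (x - 1) / k + 1 = t then if (x - 1) % k = i then 1 else 0 else 0

lemma sweep_nonneg (k i x t : ℕ) : 0 ≤ sweep k i x t := by
  unfold sweep
  split_ifs <;> norm_num

lemma substochastic_sweep (k M T i : ℕ) : Substochastic M T (sweep k i) := by
  refine ⟨sweep_nonneg k i, fun x _ => ?_, fun t _ => ?_⟩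
  · simp only [sweep, Finset.sum_ite_eq]
    split_ifs <;> norm_num
  · simp only [sweep, ← ite_and, Finset.sum_boole]
    norm_cast
    refine Finset.card_le_one.2 fun x hx y hy => ?_
    simp only [mem_filter, mem_Icc] at hx hy
    have hdiv : (x - 1) / k = (y - 1) / k := by lia
    have hmod : (x - 1) % k = (y - 1) % k := by lia
    have hxy : x - 1 = y - 1 := by
      rw [← Nat.div_add_mod (x - 1) k, ← Nat.div_add_mod (y - 1) k, hdiv, hmod]
    lia

lemma Nbar_sweep_eq_zero {k T x : ℕ} (hx : x ∈ Icc 1 (k * T)) :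
    Nbar (sweep k ((x - 1) % k)) x T = 0 := by
  rw [mem_Icc] at hx
  have hlt : (x - 1) / k < T := Nat.div_lt_of_lt_mul (by lia)
  have hmem : (x - 1) / k + 1 ∈ Icc 1 T := mem_Icc.2 ⟨by lia, hlt⟩
  simp only [Nbar, sweep, Finset.sum_ite_eq, if_pos hmem, if_true, sub_self]

lemma Nbar_const (c : ℝ) (x t : ℕ) : Nbar (fun _ _ => c) x t = 1 - t * c := by
  simp [Nbar]

/-- Against the uniform strategy all boxes have the same value in each round, so any strategy
whose columns are full is a best response. -/
lemma exUtil_uniform_le {k T M : ℕ} (hM : 0 < M) (hTM : T ≤ M) {f : ℕ → ℝ}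
    (hf : ∀ x ∈ Icc 1 M, f x = 1 / (M : ℝ)) {B : ℕ → ℕ → ℝ} (hB : Substochastic M T B) :
    exUtil M T k f (fun _ _ => 1 / (M : ℝ)) B ≤
      exUtil M T k f (fun _ _ => 1 / (M : ℝ)) (fun _ _ => 1 / (M : ℝ)) := by
  have hM' : (0 : ℝ) < M := Nat.cast_pos.2 hM
  refine Finset.sum_le_sum fun t ht => ?_
  have hval : ∀ x ∈ Icc 1 M, exVal k f (fun _ _ => 1 / (M : ℝ)) x t =
      1 / (M : ℝ) * (1 - t * (1 / (M : ℝ))) ^ (k - 1) := fun x hx => by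
    rw [exVal, hf x hx, Nbar_const]
  have htM : (t : ℝ) ≤ M := Nat.cast_le.2 ((mem_Icc.1 ht).2.trans hTM)
  have hbar : 0 ≤ 1 - (t : ℝ) * (1 / (M : ℝ)) := by
    rw [mul_one_div, sub_nonneg]
    exact (div_le_one hM').2 htM
  have hfactor : ∀ D : ℕ → ℕ → ℝ,
      ∑ x ∈ Icc 1 M, D x t * exVal k f (fun _ _ => 1 / (M : ℝ)) x t =
        (∑ x ∈ Icc 1 M, D x t) *
          (1 / (M : ℝ) * (1 - t * (1 / (M : ℝ))) ^ (k - 1)) := fun D => by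
    rw [Finset.sum_mul]
    exact Finset.sum_congr rfl fun x hx => by rw [hval x hx]
  rw [hfactor, hfactor (fun _ _ => 1 / (M : ℝ))]
  refine mul_le_mul_of_nonneg_right ((hB.2.2 t ht).trans_eq ?_) (by positivity)
  simp [hM'.ne']

lemma sum_uniform {M : ℕ} (hM : 0 < M) {f : ℕ → ℝ}
    (hf : ∀ x ∈ Icc 1 M, f x = 1 / (M : ℝ)) : ∑ x ∈ Icc 1 M, f x = 1 := by
  have hM' : (M : ℝ) ≠ 0 := Nat.cast_ne_zero.2 hM.ne'
  rw [Finset.sum_congr rfl hf]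
  simp [hM']

/-- tightness of the PoA bound for the exclusive policy. With `M = k·T` and the
uniform distribution, the uniform strategy `A_unif(x,t) = 1/M` is a symmetric equilibrium,
its symmetric profile has success probability exactly `1 - (1 - 1/k)^k`, while some profile
of `k` strategies has success probability `1`. -/
theorem exclusive_PoA_tight
    (k T M : ℕ) (hk : 2 ≤ k) (hT : 1 ≤ T) (hM : M = k * T)
    (f : ℕ → ℝ) (hf : ∀ x ∈ Icc 1 M, f x = 1 / (M : ℝ)) :
    (∀ B, Substochastic M T B →
      exUtil M T k f (fun _ _ => 1 / (M : ℝ)) B ≤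
        exUtil M T k f (fun _ _ => 1 / (M : ℝ)) (fun _ _ => 1 / (M : ℝ))) ∧
    success M T f (Multiset.replicate k (fun _ _ => 1 / (M : ℝ))) =
      1 - (1 - 1 / (k : ℝ)) ^ k ∧
    (∃ P : Multiset (ℕ → ℕ → ℝ), Multiset.card P = k ∧
      (∀ A ∈ P, Substochastic M T A) ∧ success M T f P = 1) := by
  have hk0 : 0 < k := by lia
  have hM0 : 0 < M := hM ▸ Nat.mul_pos hk0 hT
  have hTM : T ≤ M := hM ▸ Nat.le_mul_of_pos_left T hk0
  have hsum := sum_uniform hM0 hf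
  refine ⟨fun B hB => exUtil_uniform_le hM0 hTM hf hB, ?_,
    (Multiset.range k).map (sweep k), by simp, ?_, ?_⟩
  · have hTk : (T : ℝ) * (1 / (M : ℝ)) = 1 / k := by
      have hT' : (T : ℝ) ≠ 0 := Nat.cast_ne_zero.2 (by lia)
      rw [hM, Nat.cast_mul]
      field_simp
    simp only [success, Multiset.map_replicate, Multiset.prod_replicate, Nbar_const, hTk]
    rw [← Finset.sum_mul, hsum, one_mul]
  · intro A hA
    obtain ⟨i, -, rfl⟩ := Multiset.mem_map.1 hA
    exact substochastic_sweep k M T i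
  · rw [success]
    refine Eq.trans ?_ hsum
    refine Finset.sum_congr rfl fun x hx => ?_
    rw [Multiset.prod_eq_zero, sub_zero, mul_one]
    rw [← Nbar_sweep_eq_zero (hM ▸ hx)]
    exact Multiset.mem_map_of_mem _
      (Multiset.mem_map_of_mem _ (Multiset.mem_range.2 (Nat.mod_lt _ hk0)))
end

section
/- In a symmetric monotonously scalable game, if ε ≥ 0, k ≥ 1, ℓ ≥ 0 and A is a symmetric (1+ε)-equilibrium for k players, then A is a symmetric (1+ε)(1+ℓ/k)-equilibrium when played by k+ℓ players: for every strategy B, U_{A^{k+ℓ−1}}(B) ≤ (1+ε)(1+ℓ/k)·U_{A^{k+ℓ−1}}(A). -/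
/-- in a symmetric monotonously scalable game (utilities are given by
`U P B`, the payoff of an extra player playing `B` against the multiset `P` of other
players; the total utility `σ(P) = ∑_{A ∈ P} U (P - A) A` is monotone nondecreasing in `P`,
and individual utilities `U P B` are monotone nonincreasing in `P`), if `A` is a symmetric
`(1+ε)`-equilibrium for `k` players, then `A` is a symmetric `(1+ε)(1+ℓ/k)`-equilibrium
when played by `k + ℓ` players. -/
theorem monotonously_scalable_robust {S : Type*} [DecidableEq S]
    (U : Multiset S → S → ℝ)
    (hσ : ∀ P P' : Multiset S, P ≤ P' →
      (P.map fun A => U (P.erase A) A).sum ≤ (P'.map fun A => U (P'.erase A) A).sum)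
    (hU : ∀ P P' : Multiset S, P ≤ P' → ∀ B : S, U P' B ≤ U P B)
    (ε : ℝ) (hε : 0 ≤ ε) (k ℓ : ℕ) (hk : 1 ≤ k) (A : S)
    (hEq : ∀ B : S, U (Multiset.replicate (k - 1) A) B ≤
      (1 + ε) * U (Multiset.replicate (k - 1) A) A) :
    ∀ B : S, U (Multiset.replicate (k + ℓ - 1) A) B ≤
      (1 + ε) * (1 + (ℓ : ℝ) / (k : ℝ)) * U (Multiset.replicate (k + ℓ - 1) A) A := by
  intro B
  have hk0 : (0 : ℝ) < k := by exact_mod_cast hk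
  have total (n : ℕ) :
      ((Multiset.replicate n A).map fun C => U ((Multiset.replicate n A).erase C) C).sum =
        n * U (Multiset.replicate (n - 1) A) A := by
    cases n <;> simp [Multiset.replicate_succ, add_mul, add_comm]
  have hA := hσ _ _ (Multiset.replicate_le_replicate A |>.2 (Nat.le_add_right k ℓ))
  rw [total, total] at hA
  calc U (Multiset.replicate (k + ℓ - 1) A) B
      ≤ U (Multiset.replicate (k - 1) A) B :=
        hU _ _ (Multiset.replicate_le_replicate A |>.2 (by omega)) B
    _ ≤ (1 + ε) * U (Multiset.replicate (k - 1) A) A := hEq B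
    _ ≤ (1 + ε) * ((1 + (ℓ : ℝ) / k) * U (Multiset.replicate (k + ℓ - 1) A) A) := by
        gcongr
        refine le_of_mul_le_mul_left (hA.trans_eq ?_) hk0
        push_cast
        field_simp
    _ = _ := by ring
end
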